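/- Let A = (𝒜_1, …, 𝒜_n) be a collection of n finite nonempty subsets of ℤ^n with minimal defect d(A) = 0, let k ≥ 1, and let V ⊆ ℝ^n be a linear subspace with dim_ℝ V = n − k such that every proper subset J ⊊ {1, …, n} with V ⊆ L(J) has def(J) > 0. Then the number of indices i ∈ {1, …, n} with L({i}) ⊆ V is at most n − k − 1. -/

import Mathlib

noncomputable section

/-- `L(J)`: the `ℝ`-linear span of all differences `a - b` with `a, b ∈ B i` for some `i ∈ J`. -/
def colSpan {ι V : Type*} [AddCommGroup V] [Module ℝ V]
    (B : ι → Set V) (J : Set ι) : Submodule ℝ V :=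
  Submodule.span ℝ {v | ∃ i ∈ J, ∃ a ∈ B i, ∃ b ∈ B i, v = a - b}

/-- The defect `def(J) = dim L(J) - |J|`. -/
def colDefect {ι V : Type*} [AddCommGroup V] [Module ℝ V]
    (B : ι → Set V) (J : Finset ι) : ℤ :=
  (Module.finrank ℝ (colSpan B (J : Set ι)) : ℤ) - (J.card : ℤ)

/-- The minimal defect `min_{J ⊆ S} def(J)` over all subsets of `S` (including `∅`). -/
def colMinDefectOn {ι V : Type*} [AddCommGroup V] [Module ℝ V]
    (B : ι → Set V) (S : Finset ι) : ℤ :=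
  S.powerset.inf' ⟨∅, Finset.empty_mem_powerset S⟩ (fun J => colDefect B J)

/-- A finite subset of `ℤ^n` viewed inside `ℝ^n`. -/
def realize {n : ℕ} (A : Finset (Fin n → ℤ)) : Set (Fin n → ℝ) :=
  (fun a : Fin n → ℤ => fun j => (a j : ℝ)) '' (A : Set (Fin n → ℤ))

/-- The monomial `p^a = ∏_j p_j^{a_j}` as an element of `ℂˣ`. -/
def mon {n : ℕ} (p : Fin n → ℂˣ) (a : Fin n → ℤ) : ℂˣ :=
  ∏ j, p j ^ a j

/-- Evaluation of a Laurent polynomial `f` with support in `A` at `p ∈ (ℂ*)^n`: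
`f(p) = ∑_{a ∈ A} f_a · p^a`. -/
def evalL {n : ℕ} {A : Finset (Fin n → ℤ)} (f : {x // x ∈ A} → ℂ) (p : Fin n → ℂˣ) : ℂ :=
  ∑ a : {x // x ∈ A}, f a * (mon p a.1 : ℂ)

theorem colSpan_le_of_forall_singleton {ι V : Type*} [AddCommGroup V] [Module ℝ V]
    {B : ι → Set V} {J : Set ι} {W : Submodule ℝ V} (h : ∀ i ∈ J, colSpan B {i} ≤ W) :
    colSpan B J ≤ W := by
  refine Submodule.span_le.2 ?_
  rintro v ⟨i, hi, a, ha, b, hb, rfl⟩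
  exact h i hi (Submodule.subset_span ⟨i, rfl, a, ha, b, hb, rfl⟩)

theorem colMinDefectOn_le {ι V : Type*} [AddCommGroup V] [Module ℝ V]
    (B : ι → Set V) {S J : Finset ι} (hJ : J ⊆ S) :
    colMinDefectOn B S ≤ colDefect B J :=
  Finset.inf'_le _ (Finset.mem_powerset.2 hJ)

/-- If `d(A) = 0`, `V ⊆ ℝ^n` is a subspace of dimension `n − k` (`k ≥ 1`)
such that every proper subset `J` with `V ⊆ L(J)` has positive defect, then at most
`n − k − 1` of the indices satisfy `L({i}) ⊆ V`. -/
theorem card_small_supports_le {n : ℕ} (hn : 1 ≤ n)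
    (A : Fin n → Finset (Fin n → ℤ)) (hA : ∀ i, (A i).Nonempty)
    (hd : colMinDefectOn (fun i => realize (A i)) Finset.univ = 0)
    (k : ℕ) (hk : 1 ≤ k) (V : Submodule ℝ (Fin n → ℝ)) (hV : Module.finrank ℝ V + k = n)
    (hpos : ∀ J : Finset (Fin n), J ⊂ Finset.univ →
      V ≤ colSpan (fun i => realize (A i)) (J : Set (Fin n)) →
        0 < colDefect (fun i => realize (A i)) J) :
    (Nat.card {i : Fin n // colSpan (fun i' => realize (A i')) ({i} : Set (Fin n)) ≤ V} : ℤ) ≤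
      (n : ℤ) - k - 1 := by
  classical
  set B := fun i => realize (A i)
  set J : Finset (Fin n) := Finset.univ.filter fun i => colSpan B {i} ≤ V with hJ
  have hcard : Nat.card {i : Fin n // colSpan B {i} ≤ V} = J.card := by
    rw [Nat.card_eq_fintype_card, Fintype.card_subtype]
  have hle : colSpan B (J : Set (Fin n)) ≤ V :=
    colSpan_le_of_forall_singleton fun i hi => by simpa [hJ] using hi
  have hfin := Submodule.finrank_mono hle
  have hdef : 0 ≤ colDefect B J := hd ▸ colMinDefectOn_le B (Finset.subset_univ J)
  rw [hcard]
  by_contra! hlt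
  unfold colDefect at hdef
  have heq : colSpan B (J : Set (Fin n)) = V :=
    Submodule.eq_of_le_of_finrank_le hle (by omega)
  have hproper : J ⊂ Finset.univ := by
    refine Finset.ssubset_univ_iff.2 fun h => ?_
    have hc : J.card = n := by rw [h, Finset.card_univ, Fintype.card_fin]
    omega
  have hgt := hpos J hproper heq.ge
  unfold colDefect at hgt
  omega
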